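/- Let k ≥ 1 be an integer, N > 1, α ∈ (0, (N−1)/(2N)), and let C, C₁, C₂, C₃ > 0. Suppose φ : (0, r₁) → (0,∞) satisfies φ(ρ) ≤ C·ρ·(ln^{(k+2)}(1/ρ))^{αN} for all ρ ∈ (0, r₁) (with r₁ small enough that ln^{(k+2)}(1/ρ) > 0 on this interval). Define δ(ρ) = (1/(4C₁²))·[exp^{(k)}(C₂·(φ(3ρ)/(3ρ))^{2/(N−1)})]^{-1}. Then for any r₀ ∈ (0, r₁/3), setting r_j = r₀/4^{j} and λ_j = 2^{−(3 + C₃/δ(r_j)²)}, the series ∑_{j=1}^{∞} λ_j diverges. -/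

import Mathlib

open Filter Topology Asymptotics in
theorem aux_sub (f g : ℕ → ℝ) (c : ℝ) (h : f =o[atTop] g) (hg : Tendsto g atTop atTop) :
    Tendsto (fun n => g n - c * f n) atTop atTop := by
  have h1 : (fun n => c * f n) =o[atTop] g := h.const_mul_left c
  exact ((IsEquivalent.refl (u := g)).sub_isLittleO h1).symm.tendsto_atTop hg

open Filter Topology Asymptotics in
theorem aux_iter (m : ℕ) (f g : ℕ → ℝ) (h : f =o[atTop] g) (hg : Tendsto g atTop atTop) :
    (fun n => Real.exp^[m] (f n)) =o[atTop] (fun n => Real.exp^[m] (g n)) ∧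
    Tendsto (fun n => Real.exp^[m] (g n)) atTop atTop := by
  induction m with
  | zero => exact ⟨h, hg⟩
  | succ m ih =>
    obtain ⟨h1, h2⟩ := ih
    simp only [Function.iterate_succ', Function.comp]
    refine ⟨?_, Real.tendsto_exp_atTop.comp h2⟩
    rw [Real.isLittleO_exp_comp_exp_comp]
    simpa using aux_sub _ _ 1 h1 h2

open Filter Topology Asymptotics in
theorem aux_sq (k : ℕ) (hk : 1 ≤ k) (f g : ℕ → ℝ) (h : f =o[atTop] g)
    (hg : Tendsto g atTop atTop) :
    (fun n => (Real.exp^[k] (f n)) ^ 2) =o[atTop] (fun n => Real.exp^[k] (g n)) := by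
  obtain ⟨m, rfl⟩ : ∃ m, k = m + 1 := ⟨k - 1, by omega⟩
  obtain ⟨h1, h2⟩ := aux_iter m f g h hg
  simp only [Function.iterate_succ', Function.comp, ← Real.exp_nat_mul]
  rw [Real.isLittleO_exp_comp_exp_comp]
  exact aux_sub _ _ _ h1 h2

open Filter Topology Asymptotics in
theorem aux_log (m : ℕ) (x : ℕ → ℝ) (hx : Tendsto x atTop atTop) :
    Tendsto (fun n => Real.log^[m] (x n)) atTop atTop ∧
    ∀ᶠ n in atTop, Real.exp^[m] (Real.log^[m] (x n)) = x n := by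
  induction m with
  | zero => exact ⟨hx, by simp⟩
  | succ m ih =>
    obtain ⟨h1, h2⟩ := ih
    constructor
    · simp only [Function.iterate_succ', Function.comp]
      exact Real.tendsto_log_atTop.comp h1
    · filter_upwards [h2, h1.eventually_gt_atTop 0] with n hn hp
      rw [Function.iterate_succ_apply, Function.iterate_succ_apply', Real.exp_log hp, hn]

open Filter Topology Asymptotics in

/-- Under the superradius bound
`φ(ρ) ≤ C·ρ·(ln^[k+2](1/ρ))^(αN)` with `α ∈ (0,(N−1)/(2N))`, setting
`δ(ρ) = (1/(4C₁²))·[exp^[k](C₂·(φ(3ρ)/(3ρ))^(2/(N−1)))]⁻¹`, `r_j = r₀/4^j` and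
`λ_j = 2^(−(3 + C₃/δ(r_j)²))`, the series `∑_{j=1}^∞ λ_j` diverges. -/
theorem summability_condition_holds
    (k : ℕ) (hk : 1 ≤ k) (N : ℝ) (hN : 1 < N)
    (α : ℝ) (hα : α ∈ Set.Ioo (0 : ℝ) ((N - 1) / (2 * N)))
    (C C1 C2 C3 : ℝ) (hC : 0 < C) (hC1 : 0 < C1) (hC2 : 0 < C2) (hC3 : 0 < C3)
    (r1 : ℝ) (hr1 : 0 < r1)
    (φ : ℝ → ℝ)
    (hφpos : ∀ ρ ∈ Set.Ioo (0 : ℝ) r1, 0 < φ ρ)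
    (hlogpos : ∀ ρ ∈ Set.Ioo (0 : ℝ) r1, 0 < Real.log^[k + 2] (1 / ρ))
    (hφ : ∀ ρ ∈ Set.Ioo (0 : ℝ) r1,
      φ ρ ≤ C * ρ * (Real.log^[k + 2] (1 / ρ)) ^ (α * N))
    (r0 : ℝ) (hr0 : r0 ∈ Set.Ioo (0 : ℝ) (r1 / 3)) :
    ¬ Summable (fun j : ℕ =>
      (2 : ℝ) ^ (-(3 + C3 /
        ((1 / (4 * C1 ^ 2)) *
          (Real.exp^[k] (C2 * (φ (3 * (r0 / 4 ^ (j + 1))) / (3 * (r0 / 4 ^ (j + 1)))) ^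
            (2 / (N - 1))))⁻¹) ^ 2))) := by
  classical
  obtain ⟨hr0, hr0'⟩ := hr0
  obtain ⟨hα0, hα1⟩ := hα
  have hN1 : 0 < N - 1 := by linarith
  set ρ : ℕ → ℝ := fun j => 3 * (r0 / 4 ^ (j + 1)) with hρ
  have hρ0 : ∀ j, 0 < ρ j := fun j => by positivity
  have hρ1 : ∀ j, ρ j < r1 := fun j => by
    have : r0 / 4 ^ (j + 1) ≤ r0 := div_le_self hr0.le (one_le_pow₀ (by norm_num))
    simp only [hρ]; linarith
  set x : ℕ → ℝ := fun j => Real.log (1 / ρ j) with hxdef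
  have hxe : ∀ j, x j = ((j : ℝ) + 1) * Real.log 4 - Real.log (3 * r0) := fun j => by
    have : (1 : ℝ) / ρ j = 4 ^ (j + 1) / (3 * r0) := by simp only [hρ]; field_simp
    simp only [hxdef]
    rw [this, Real.log_div (by positivity) (by positivity), Real.log_pow]
    push_cast; ring
  have hj : Tendsto (fun j : ℕ => (j : ℝ) + 1) atTop atTop :=
    tendsto_atTop_add_const_right _ _ tendsto_natCast_atTop_atTop
  have hl4 : 0 < Real.log 4 := Real.log_pos (by norm_num)
  have hx : Tendsto x atTop atTop := by
    rw [funext hxe]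
    exact tendsto_atTop_add_const_right _ _ (hj.atTop_mul_const hl4)
  have hxO : x =O[atTop] (fun j : ℕ => (j : ℝ) + 1) := by
    rw [funext hxe]
    refine IsBigO.sub ?_ ?_
    · simpa [mul_comm] using (isBigO_refl (fun j : ℕ => (j : ℝ) + 1) atTop).const_mul_left (Real.log 4)
    · exact (isLittleO_const_left.2 (Or.inr (tendsto_norm_atTop_atTop.comp hj))).isBigO
  obtain ⟨hlx, -⟩ := aux_log 1 x hx
  obtain ⟨hy, hyx⟩ := aux_log k (fun n => Real.log (x n)) (by simpa using hlx)
  set y : ℕ → ℝ := fun n => Real.log^[k] (Real.log (x n)) with hydef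
  have hyr : ∀ j, Real.log^[k + 2] (1 / ρ j) = y j := fun j => rfl
  set β : ℝ := (α * N) * (2 / (N - 1)) with hβ
  have hβ1 : β < 1 := by
    rw [lt_div_iff₀ (by linarith)] at hα1
    rw [hβ, ← mul_div_assoc, div_lt_one hN1]; linarith
  set f : ℕ → ℝ := fun j => C2 * (C ^ (2 / (N - 1)) * y j ^ β) with hf
  have hfy : f =o[atTop] y := by
    have h1 : (fun t : ℝ => t ^ β) =o[atTop] (fun t : ℝ => t ^ (1 : ℝ)) := by
      refine isLittleO_of_tendsto' ?_ ?_
      · filter_upwards [eventually_gt_atTop 0] with t ht h0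
        simp at h0; exact absurd h0 ht.ne'
      · refine (tendsto_rpow_neg_atTop (sub_pos.2 hβ1)).congr' ?_
        filter_upwards [eventually_gt_atTop 0] with t ht
        rw [← Real.rpow_sub ht]; congr 1; ring
    have h2 := (h1.comp_tendsto hy).const_mul_left (C2 * C ^ (2 / (N - 1)))
    simpa [hf, Function.comp_def, mul_assoc] using h2
  have hsq := aux_sq k hk f y hfy hy
  have hG := (aux_iter k f y hfy hy).2
  set K : ℝ := C3 * (4 * C1 ^ 2) ^ 2 with hK
  have hmain : ∀ᶠ j in atTop, (3 + K * (Real.exp^[k] (f j)) ^ 2) * Real.log 2 ≤ Real.log (x j) := by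
    have h1 := aux_sub _ _ (K * Real.log 2) hsq hG
    filter_upwards [h1.eventually_ge_atTop (3 * Real.log 2), hyx] with j h1 h2
    rw [h2] at h1
    linarith
  intro hS
  have hle : ∀ j : ℕ, Real.exp^[k] (C2 * (φ (ρ j) / ρ j) ^ (2 / (N - 1))) ≤ Real.exp^[k] (f j) := by
    intro j
    apply Real.exp_monotone.iterate k
    have hp := hφpos (ρ j) ⟨hρ0 j, hρ1 j⟩
    have hb := hφ (ρ j) ⟨hρ0 j, hρ1 j⟩
    have hl := hlogpos (ρ j) ⟨hρ0 j, hρ1 j⟩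
    rw [hyr] at hb hl
    simp only [hf, hβ]
    rw [Real.rpow_mul hl.le, ← Real.mul_rpow hC.le (by positivity)]
    have : φ (ρ j) / ρ j ≤ C * y j ^ (α * N) := by
      rw [div_le_iff₀ (hρ0 j)]; linarith
    have h0 : 0 ≤ φ (ρ j) / ρ j := (div_pos hp (hρ0 j)).le
    gcongr
  have hEpos : ∀ (j : ℕ), 0 < Real.exp^[k] (C2 * (φ (ρ j) / ρ j) ^ (2 / (N - 1))) := by
    intro j
    obtain ⟨m, rfl⟩ : ∃ m, k = m + 1 := ⟨k - 1, by omega⟩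
    rw [Function.iterate_succ_apply']
    exact Real.exp_pos _
  have hxS : Summable (fun j => (x j)⁻¹) := by
    refine Summable.of_norm_bounded_eventually_nat hS ?_
    filter_upwards [hmain, hx.eventually_gt_atTop 0] with j h1 h2
    rw [Real.norm_of_nonneg (by positivity)]
    change (x j)⁻¹ ≤ (2 : ℝ) ^ (-(3 + C3 / ((1 / (4 * C1 ^ 2)) *
      (Real.exp^[k] (C2 * (φ (ρ j) / ρ j) ^ (2 / (N - 1))))⁻¹) ^ 2))
    have hE := hEpos j
    have hl := hle j
    set E := Real.exp^[k] (C2 * (φ (ρ j) / ρ j) ^ (2 / (N - 1)))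
    have e1 : C3 / ((1 / (4 * C1 ^ 2)) * E⁻¹) ^ 2 = K * E ^ 2 := by
      rw [hK]; field_simp
    rw [e1, Real.rpow_def_of_pos (by norm_num), ← Real.exp_log (inv_pos.2 h2), Real.log_inv]
    apply Real.exp_le_exp.2
    have hK0 : 0 < K := by positivity
    have h3 : (3 + K * E ^ 2) * Real.log 2 ≤ (3 + K * (Real.exp^[k] (f j)) ^ 2) * Real.log 2 := by
      have := Real.log_pos (show (1 : ℝ) < 2 by norm_num)
      gcongr
    linarith
  have hO : (fun j : ℕ => ((j : ℝ) + 1)⁻¹) =O[atTop] (fun j => (x j)⁻¹) := by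
    refine hxO.inv_rev ?_
    filter_upwards [hx.eventually_gt_atTop 0] with j h1 h2
    exact absurd h2 h1.ne'
  have := summable_of_isBigO_nat hxS hO
  have h4 : Summable (fun j : ℕ => ((j : ℝ))⁻¹) := by
    rw [← summable_nat_add_iff 1]; simpa using this
  exact Real.not_summable_natCast_inv h4
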